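/- Assume the functions {x ↦ exp(αᵀx)}_{α∈𝒜} are linearly independent on X. Then the circuit graph is generated by the reduced circuits: G_X(𝒜) = cone({φ_λ : λ ∈ Λ*_X(𝒜)} ∪ {(0,1)}). -/

import Mathlib

open Finset

/-- Dot product on `Fin n → ℝ`. -/
noncomputable def dotp {n : ℕ} (y x : Fin n → ℝ) : ℝ := ∑ i, y i * x i

/-- Support function `σ_X : ℝⁿ → ℝ ∪ {±∞}` of a set `X ⊆ ℝⁿ`. -/
noncomputable def suppFn {n : ℕ} (X : Set (Fin n → ℝ)) (y : Fin n → ℝ) : EReal :=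
  ⨆ x ∈ X, ((dotp y x : ℝ) : EReal)

/-- The linear map `𝒜 : ℝ^𝒜 → ℝⁿ`, `ν ↦ Σ_α ν_α α`. -/
noncomputable def Amap {n m : ℕ} (A : Fin m → Fin n → ℝ) (ν : Fin m → ℝ) : Fin n → ℝ :=
  fun j => ∑ i, ν i * A i j

/-- `N_β = {ν : ν_α ≥ 0 (α ≠ β), Σ ν_α = 0}`. -/
def Nbeta {m : ℕ} (b : Fin m) : Set (Fin m → ℝ) :=
  {ν | (∀ i, i ≠ b → 0 ≤ ν i) ∧ ∑ i, ν i = 0}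

/-- Two vectors are proportional if one is a scalar multiple of the other. -/
def Proportional {m : ℕ} (u v : Fin m → ℝ) : Prop :=
  ∃ t : ℝ, u = t • v ∨ v = t • u

/-- The augmented support function `ν ↦ σ_X(-𝒜ν)`. -/
noncomputable def sigA {n m : ℕ} (X : Set (Fin n → ℝ)) (A : Fin m → Fin n → ℝ)
    (ν : Fin m → ℝ) : EReal :=
  suppFn X (-(Amap A ν))

/-- The map `ν ↦ σ_X(-𝒜ν)` is affine on the segment `[ν1, ν2]`. -/
def SigmaAffineOnSeg {n m : ℕ} (X : Set (Fin n → ℝ)) (A : Fin m → Fin n → ℝ)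
    (ν1 ν2 : Fin m → ℝ) : Prop :=
  ∀ t : ℝ, t ∈ Set.Icc (0:ℝ) 1 →
    sigA X A (t • ν1 + (1 - t) • ν2) =
      (t : EReal) * sigA X A ν1 + ((1 - t : ℝ) : EReal) * sigA X A ν2

/-- `ν` is an `X`-circuit of `𝒜` (with negative index allowed only at `b`). -/
def IsXCircuit {n m : ℕ} (X : Set (Fin n → ℝ)) (A : Fin m → Fin n → ℝ)
    (b : Fin m) (ν : Fin m → ℝ) : Prop :=
  ν ∈ Nbeta b ∧ ν ≠ 0 ∧ sigA X A ν < ⊤ ∧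
  ¬ ∃ (ν1 ν2 : Fin m → ℝ) (θ : ℝ), ν1 ∈ Nbeta b ∧ ν2 ∈ Nbeta b ∧
      ¬ Proportional ν1 ν2 ∧ θ ∈ Set.Ioo (0:ℝ) 1 ∧
      ν = θ • ν1 + (1 - θ) • ν2 ∧ SigmaAffineOnSeg X A ν1 ν2

/-- All finite nonnegative combinations of elements of `S` (including `0`). -/
def coneHull {E : Type*} [AddCommMonoid E] [SMul ℝ E] (S : Set E) : Set E :=
  {x | ∃ (k : ℕ) (t : Fin k → ℝ) (v : Fin k → E),
    (∀ j, 0 ≤ t j) ∧ (∀ j, v j ∈ S) ∧ x = ∑ j, t j • v j}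

/-- `v` is an edge generator of the convex cone `K`. -/
def IsEdgeGenerator {E : Type*} [AddCommMonoid E] [SMul ℝ E] (K : Set E) (v : E) : Prop :=
  v ≠ 0 ∧ v ∈ K ∧ ∀ u ∈ K, ∀ w ∈ K, v = u + w →
    (∃ a : ℝ, 0 ≤ a ∧ u = a • v) ∧ (∃ b : ℝ, 0 ≤ b ∧ w = b • v)

/-- The `X`-AGE cone `C_X(𝒜, β)`, as a cone of coefficient vectors. -/
def AgeCone {n m : ℕ} (X : Set (Fin n → ℝ)) (A : Fin m → Fin n → ℝ) (b : Fin m) :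
    Set (Fin m → ℝ) :=
  {c | (∀ i, i ≠ b → 0 ≤ c i) ∧ ∀ x ∈ X, 0 ≤ ∑ i, c i * Real.exp (dotp (A i) x)}

/-- The `X`-SAGE cone `C_X(𝒜) = Σ_β C_X(𝒜, β)`. -/
def Sage {n m : ℕ} (X : Set (Fin n → ℝ)) (A : Fin m → Fin n → ℝ) : Set (Fin m → ℝ) :=
  {c | ∃ f : Fin m → (Fin m → ℝ), (∀ b, f b ∈ AgeCone X A b) ∧ c = ∑ b, f b}

/-- One summand of the relative entropy, with the conventions `0·log 0 = 0` and
`D = ∞` if `a > 0` while `c ≤ 0`. -/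
noncomputable def relEnt (a c : ℝ) : EReal :=
  if a = 0 then 0 else if 0 < c then ((a * Real.log (a / c) : ℝ) : EReal) else ⊤

/-- The relative entropy `D(ν_{∖β}, e · c_{∖β})`. -/
noncomputable def relEntSum {m : ℕ} (b : Fin m) (ν c : Fin m → ℝ) : EReal :=
  ∑ i ∈ Finset.univ.erase b, relEnt (ν i) (Real.exp 1 * c i)

/-- Condition (★): `ν ∈ N_β`, `ν ≠ 0`, `σ_X(-𝒜ν) + D(ν_{∖β}, e c_{∖β}) ≤ c_β`. -/
def StarCond {n m : ℕ} (X : Set (Fin n → ℝ)) (A : Fin m → Fin n → ℝ)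
    (b : Fin m) (c ν : Fin m → ℝ) : Prop :=
  ν ∈ Nbeta b ∧ ν ≠ 0 ∧ sigA X A ν + relEntSum b ν c ≤ (c b : EReal)

/-- The `λ`-witnessed AGE cone `C_X(𝒜, λ)` for a normalized `λ` with `λ_β = -1`. -/
noncomputable def WitnessCone {n m : ℕ} (X : Set (Fin n → ℝ)) (A : Fin m → Fin n → ℝ)
    (b : Fin m) (l : Fin m → ℝ) : Set (Fin m → ℝ) :=
  {c | (∀ i, i ≠ b → 0 ≤ c i) ∧
    (-(c b)) * Real.exp ((sigA X A l).toReal) ≤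
      ∏ i ∈ Finset.univ.filter (fun i => 0 < l i), (c i / l i) ^ (l i)}

/-- Normalized `X`-circuits in `N_β`. -/
def LambdaB {n m : ℕ} (X : Set (Fin n → ℝ)) (A : Fin m → Fin n → ℝ) (b : Fin m) :
    Set (Fin m → ℝ) :=
  {l | IsXCircuit X A b l ∧ l b = -1}

/-- All normalized `X`-circuits of `𝒜`. -/
def Lambda {n m : ℕ} (X : Set (Fin n → ℝ)) (A : Fin m → Fin n → ℝ) : Set (Fin m → ℝ) :=
  ⋃ b, LambdaB X A b

/-- Functional form `φ_λ = (λ, σ_X(-𝒜λ)) ∈ ℝ^𝒜 × ℝ`. -/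
noncomputable def phiVec {n m : ℕ} (X : Set (Fin n → ℝ)) (A : Fin m → Fin n → ℝ)
    (l : Fin m → ℝ) : (Fin m → ℝ) × ℝ :=
  (l, (sigA X A l).toReal)

/-- Functional form as an affine function `φ_λ(y) = Σ y_α λ_α + σ_X(-𝒜λ)`. -/
noncomputable def phiFun {n m : ℕ} (X : Set (Fin n → ℝ)) (A : Fin m → Fin n → ℝ)
    (l : Fin m → ℝ) (y : Fin m → ℝ) : ℝ :=
  (∑ i, y i * l i) + (sigA X A l).toReal

/-- The circuit graph `G_X(𝒜)`. -/
noncomputable def circuitGraph {n m : ℕ} (X : Set (Fin n → ℝ)) (A : Fin m → Fin n → ℝ) :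
    Set ((Fin m → ℝ) × ℝ) :=
  coneHull ((phiVec X A '' Lambda X A) ∪ {((0 : Fin m → ℝ), (1 : ℝ))})

/-- The reduced normalized `X`-circuits `Λ*_X(𝒜)`. -/
noncomputable def LambdaStar {n m : ℕ} (X : Set (Fin n → ℝ)) (A : Fin m → Fin n → ℝ) :
    Set (Fin m → ℝ) :=
  {l | l ∈ Lambda X A ∧ IsEdgeGenerator (circuitGraph X A) (phiVec X A l)}

/-- `λ`-witnessed AGE cone for a normalized circuit, with `β` recovered from `λ`. -/
noncomputable def WitnessConeL {n m : ℕ} (X : Set (Fin n → ℝ)) (A : Fin m → Fin n → ℝ)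
    (l : Fin m → ℝ) : Set (Fin m → ℝ) :=
  ⋃ b ∈ {b : Fin m | l b = -1}, WitnessCone X A b l

/-- Dual cone of a set of coefficient vectors in `ℝ^𝒜`. -/
def dualConeV {m : ℕ} (K : Set (Fin m → ℝ)) : Set (Fin m → ℝ) :=
  {v | ∀ c ∈ K, 0 ≤ ∑ i, v i * c i}

/-- Dual cone of a subset of `ℝ^𝒜 × ℝ`. -/
def dualConeP {m : ℕ} (K : Set ((Fin m → ℝ) × ℝ)) : Set ((Fin m → ℝ) × ℝ) :=
  {p | ∀ q ∈ K, 0 ≤ (∑ i, p.1 i * q.1 i) + p.2 * q.2}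

/-- The basis functions `x ↦ exp(αᵀx)`, `α ∈ 𝒜`, are linearly independent on `X`. -/
def ExpLinIndep {n m : ℕ} (X : Set (Fin n → ℝ)) (A : Fin m → Fin n → ℝ) : Prop :=
  LinearIndependent ℝ (fun i : Fin m => fun x : X => Real.exp (dotp (A i) (x : Fin n → ℝ)))

/-- `X` is a polyhedron: an intersection of finitely many closed halfspaces. -/
def IsPolyhedron {n : ℕ} (X : Set (Fin n → ℝ)) : Prop :=
  ∃ (k : ℕ) (a : Fin k → Fin n → ℝ) (bb : Fin k → ℝ),
    X = {x | ∀ i, dotp (a i) x ≤ bb i}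

/-- Minkowski sum `Σ_{l ∈ Λ} C(l)` (finite sums, one summand per `l`;
the empty sum gives `{0}`). -/
def MinkSumOver {m : ℕ} (Λ : Set (Fin m → ℝ)) (C : (Fin m → ℝ) → Set (Fin m → ℝ)) :
    Set (Fin m → ℝ) :=
  {c | ∃ (s : Finset (Fin m → ℝ)) (f : (Fin m → ℝ) → (Fin m → ℝ)),
    (↑s ⊆ Λ) ∧ (∀ l ∈ s, f l ∈ C l) ∧ c = ∑ l ∈ s, f l}

section PointedCone

variable {E : Type*} [NormedAddCommGroup E] [NormedSpace ℝ E]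

theorem coneHull_eq_hull {F : Type*} [AddCommGroup F] [Module ℝ F] (S : Set F) :
    coneHull S = (PointedCone.hull ℝ S : Set F) := by
  ext x
  rw [SetLike.mem_coe, Submodule.mem_span_set']
  constructor
  · rintro ⟨k, t, v, ht, hv, rfl⟩
    exact ⟨k, fun j => ⟨t j, ht j⟩, fun j => ⟨v j, hv j⟩, rfl⟩
  · rintro ⟨k, t, v, rfl⟩
    exact ⟨k, fun j => t j, fun j => v j, fun j => (t j).2, fun j => (v j).2, rfl⟩

theorem IsEdgeGenerator.mono {F : Type*} [AddCommMonoid F] [SMul ℝ F] {K L : Set F} {v : F}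
    (h : IsEdgeGenerator L v) (hKL : K ⊆ L) (hv : v ∈ K) : IsEdgeGenerator K v :=
  ⟨h.1, hv, fun u hu w hw huw => h.2.2 u (hKL hu) w (hKL hw) huw⟩

theorem IsEdgeGenerator.smul {F : Type*} [AddCommGroup F] [Module ℝ F] {C : PointedCone ℝ F}
    {v : F} (h : IsEdgeGenerator (C : Set F) v) {c : ℝ} (hc : 0 < c) :
    IsEdgeGenerator (C : Set F) (c • v) := by
  refine ⟨smul_ne_zero hc.ne' h.1, C.smul_mem hc.le h.2.1, fun u hu w hw huw => ?_⟩
  obtain ⟨⟨a, ha, hua⟩, b, hb, hwb⟩ := h.2.2 (c⁻¹ • u) (C.smul_mem (inv_nonneg.2 hc.le) hu)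
    (c⁻¹ • w) (C.smul_mem (inv_nonneg.2 hc.le) hw)
    (by rw [← smul_add, ← huw, inv_smul_smul₀ hc.ne'])
  rw [inv_smul_eq_iff₀ hc.ne', smul_comm] at hua hwb
  exact ⟨⟨a, ha, hua⟩, b, hb, hwb⟩

/-- The span of the smallest face of `C` containing `v`. -/
def faceSpan {F : Type*} [AddCommGroup F] [Module ℝ F] (C : PointedCone ℝ F) (v : F) :
    Submodule ℝ F where
  carrier := {u | ∃ r : ℝ, 0 ≤ r ∧ r • v - u ∈ C ∧ r • v + u ∈ C}
  zero_mem' := ⟨0, le_rfl, by simp, by simp⟩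
  add_mem' := by
    rintro a b ⟨r, hr, h₁, h₂⟩ ⟨s, hs, h₃, h₄⟩
    refine ⟨r + s, add_nonneg hr hs, ?_, ?_⟩
    · convert C.add_mem h₁ h₃ using 1; module
    · convert C.add_mem h₂ h₄ using 1; module
  smul_mem' := by
    rintro c u ⟨r, hr, h₁, h₂⟩
    refine ⟨|c| * r, by positivity, ?_, ?_⟩ <;> rcases abs_cases c with ⟨h, h'⟩ | ⟨h, h'⟩ <;> rw [h]
    · convert C.smul_mem h' h₁ using 1; module
    · convert C.smul_mem (neg_pos.2 h').le h₂ using 1; module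
    · convert C.smul_mem h' h₂ using 1; module
    · convert C.smul_mem (neg_pos.2 h').le h₁ using 1; module

theorem mem_faceSpan_of_sub_mem {F : Type*} [AddCommGroup F] [Module ℝ F] {C : PointedCone ℝ F}
    {u v : F} (hv : v ∈ C) (hu : u ∈ C) (huv : v - u ∈ C) : u ∈ faceSpan C v :=
  ⟨1, zero_le_one, by simpa using huv, by simpa using C.add_mem hv hu⟩

theorem faceSpan_mono {F : Type*} [AddCommGroup F] [Module ℝ F] {C : PointedCone ℝ F} {u v : F}
    (huv : v - u ∈ C) : faceSpan C u ≤ faceSpan C v := by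
  rintro w ⟨r, hr, h₁, h₂⟩
  refine ⟨r, hr, ?_, ?_⟩
  · convert C.add_mem h₁ (C.smul_mem hr huv) using 1; module
  · convert C.add_mem h₂ (C.smul_mem hr huv) using 1; module

/-- Moving from `v` in the direction `-u`, one leaves a closed salient cone at a point whose face
does not contain `u`. -/
theorem exists_sub_smul_mem_notMem_faceSpan {C : PointedCone ℝ E} (hC : IsClosed (C : Set E))
    {u v : E} (hv : v ∈ C) (hu : -u ∉ C) :
    ∃ s : ℝ, 0 ≤ s ∧ v - s • u ∈ C ∧ u ∉ faceSpan C (v - s • u) := by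
  set S : Set ℝ := {s | 0 ≤ s ∧ v - s • u ∈ C}
  have hSne : S.Nonempty := ⟨0, le_rfl, by simpa using hv⟩
  have hScl : IsClosed S :=
    isClosed_Ici.inter (hC.preimage (f := fun s : ℝ => v - s • u) (by fun_prop))
  have hSbd : BddAbove S := by
    by_contra hunb
    refine hu ?_
    have hlim : Filter.Tendsto (fun s : ℝ => s⁻¹ • v - u) Filter.atTop (nhds (-u)) := by
      simpa using ((tendsto_inv_atTop_zero (𝕜 := ℝ)).smul_const v).sub_const u
    refine hC.mem_of_frequently_of_tendsto (Filter.frequently_atTop.2 fun a => ?_) hlim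
    obtain ⟨s, hs, has⟩ := not_bddAbove_iff.1 hunb (max a 0)
    have hs0 : 0 < s := (le_max_right _ _).trans_lt has
    refine ⟨s, (le_max_left _ _).trans has.le, ?_⟩
    have := C.smul_mem (inv_nonneg.2 hs0.le) hs.2
    rwa [smul_sub, inv_smul_smul₀ hs0.ne'] at this
  obtain ⟨hs0, hsC⟩ := hScl.csSup_mem hSne hSbd
  refine ⟨sSup S, hs0, hsC, ?_⟩
  rintro ⟨r, hr, h₁, -⟩
  have hr1 : 0 < r + 1 := by positivity
  have hmem : sSup S + (r + 1)⁻¹ ∈ S := by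
    refine ⟨by positivity, ?_⟩
    have := C.smul_mem (inv_nonneg.2 hr1.le) (C.add_mem h₁ hsC)
    convert this using 1
    match_scalars <;> field_simp
    ring
  have := le_csSup hSbd hmem
  have : 0 < (r + 1)⁻¹ := by positivity
  linarith

/-- A closed salient cone in a finite-dimensional space is generated by its edge generators. -/
theorem mem_hull_edgeGenerators [FiniteDimensional ℝ E] {C : PointedCone ℝ E}
    (hC : IsClosed (C : Set E)) (hsal : ∀ x ∈ C, -x ∈ C → x = 0) {v : E} (hv : v ∈ C) :
    v ∈ PointedCone.hull ℝ {e | IsEdgeGenerator (C : Set E) e} := by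
  induction hd : Module.finrank ℝ (faceSpan C v) using Nat.strong_induction_on generalizing v with
  | _ d ih =>
  subst hd
  by_cases hv0 : v = 0
  · rw [hv0]; exact zero_mem _
  by_cases hedge : IsEdgeGenerator (C : Set E) v
  · exact Submodule.subset_span hedge
  obtain ⟨u, hu, w, hw, huw, hprop⟩ : ∃ u ∈ C, ∃ w ∈ C, v = u + w ∧ ∀ a : ℝ, u ≠ a • v := by
    by_contra! hcon
    refine hedge ⟨hv0, hv, fun u hu w hw huw => ?_⟩
    have key : ∀ x ∈ C, ∀ a : ℝ, x = a • v → 0 ≤ a := by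
      intro x hx a hxa
      by_contra! ha
      refine hv0 (hsal v hv ?_)
      have := C.smul_mem (inv_nonneg.2 (neg_pos.2 ha).le) hx
      rwa [hxa, smul_smul, inv_neg, neg_mul, inv_mul_cancel₀ ha.ne, neg_one_smul] at this
    obtain ⟨a, ha⟩ := hcon u hu w hw huw
    obtain ⟨b, hb⟩ := hcon w hw u hu (by rw [huw, add_comm])
    exact ⟨⟨a, key u hu a ha, ha⟩, b, key w hw b hb, hb⟩
  have hvu : v - u ∈ C := by rwa [huw, add_sub_cancel_left]
  have hu0 : u ≠ 0 := fun h => hprop 0 (by simpa using h)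
  obtain ⟨s, hs, hsC, hus⟩ :=
    exists_sub_smul_mem_notMem_faceSpan hC hv (fun h => hu0 (hsal u hu h))
  obtain ⟨r, hr, hrC, hvr⟩ :=
    exists_sub_smul_mem_notMem_faceSpan hC hu (fun h => hv0 (hsal v hv h))
  have lower : ∀ x y : E, x ∈ C → v - x ∈ C → y ∈ faceSpan C v → y ∉ faceSpan C x →
      x ∈ PointedCone.hull ℝ {e | IsEdgeGenerator (C : Set E) e} := fun x y hx hvx hyv hyx =>
    ih _ (Submodule.finrank_lt_finrank_of_lt
      (lt_of_le_of_ne (faceSpan_mono hvx) fun h => hyx (h ▸ hyv))) hx rfl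
  have h₁ := lower (v - s • u) u hsC (by simpa using C.smul_mem hs hu)
    (mem_faceSpan_of_sub_mem hv hu hvu) hus
  have h₂ := lower (u - r • v) v hrC
    (by convert C.add_mem hvu (C.smul_mem hr hv) using 1; module)
    (mem_faceSpan_of_sub_mem hv hv (by simp)) hvr
  have hsr : s * r < 1 := by
    by_contra! hge
    have h0 : v - s • u = 0 := by
      refine hsal _ hsC ?_
      convert C.add_mem (C.smul_mem hs hrC) (C.smul_mem (sub_nonneg.2 hge) hv) using 1
      module
    have hs0 : s ≠ 0 := fun h => hv0 (by simpa [h] using h0)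
    refine hprop s⁻¹ ?_
    rw [sub_eq_zero.1 h0, inv_smul_smul₀ hs0]
  have h1 : 0 < 1 - s * r := by linarith
  have := PointedCone.smul_mem _ (inv_nonneg.2 h1.le) (add_mem h₁ (PointedCone.smul_mem _ hs h₂))
  convert this using 1
  rw [eq_inv_smul_iff₀ h1.ne']
  module

/-- The image of a closed cone under a continuous linear map that vanishes only at the origin of
the cone is closed. -/
theorem isClosed_image_of_cone {F : Type*} [NormedAddCommGroup F] [NormedSpace ℝ F]
    [ProperSpace E] {C : PointedCone ℝ E} (hC : IsClosed (C : Set E)) (f : E →L[ℝ] F)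
    (hf : ∀ x ∈ C, f x = 0 → x = 0) : IsClosed (f '' (C : Set E)) := by
  obtain ⟨c, hc, hcf⟩ : ∃ c > 0, ∀ x ∈ C, c * ‖x‖ ≤ ‖f x‖ := by
    have hK : IsCompact ((C : Set E) ∩ Metric.sphere 0 1) := (isCompact_sphere 0 1).inter_left hC
    have hscale : ∀ x ∈ C, x ≠ 0 → ‖x‖⁻¹ • x ∈ (C : Set E) ∩ Metric.sphere 0 1 := fun x hx hx0 =>
      ⟨C.smul_mem (by positivity) hx, by simp [norm_smul, hx0]⟩
    rcases ((C : Set E) ∩ Metric.sphere 0 1).eq_empty_or_nonempty with hemp | hne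
    · refine ⟨1, one_pos, fun x hx => ?_⟩
      by_cases hx0 : x = 0
      · simp [hx0]
      · exact absurd (hscale x hx hx0) (by simp [hemp])
    · obtain ⟨y, hy, hmin⟩ := hK.exists_isMinOn hne (f := fun x => ‖f x‖) (by fun_prop)
      refine ⟨‖f y‖, norm_pos_iff.2 fun h => ?_, fun x hx => ?_⟩
      · have := hy.2
        rw [hf y hy.1 h] at this
        simp at this
      · by_cases hx0 : x = 0
        · simp [hx0]
        · have := hmin (hscale x hx hx0)
          have hx' : 0 < ‖x‖ := norm_pos_iff.2 hx0
          simp only [Set.mem_ofPred_eq, map_smul, norm_smul, norm_inv, norm_norm] at this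
          rwa [le_inv_mul_iff₀ hx', mul_comm] at this
  refine isClosed_of_closure_subset fun y hy => ?_
  set R := (‖y‖ + 1) / c
  have hcpt : IsCompact (f '' ((C : Set E) ∩ Metric.closedBall 0 R)) :=
    ((isCompact_closedBall 0 R).inter_left hC).image f.continuous
  suffices y ∈ closure (f '' ((C : Set E) ∩ Metric.closedBall 0 R)) by
    rw [hcpt.isClosed.closure_eq] at this
    exact Set.image_mono Set.inter_subset_left this
  have hy' := mem_closure_iff_nhds.1 hy
  refine mem_closure_iff_nhds.2 fun t ht => ?_
  obtain ⟨_, ⟨hzt, hzb⟩, x, hx, rfl⟩ :=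
    hy' (t ∩ Metric.ball y 1) (Filter.inter_mem ht (Metric.ball_mem_nhds y one_pos))
  refine ⟨f x, hzt, x, ⟨hx, ?_⟩, rfl⟩
  rw [mem_closedBall_zero_iff, le_div_iff₀ hc, mul_comm]
  refine (hcf x hx).trans ?_
  rw [mem_ball_iff_norm] at hzb
  linarith [norm_le_norm_add_norm_sub' (f x) y]

theorem mem_iSup_pointedCone {F ι : Type*} [AddCommGroup F] [Module ℝ F] [Fintype ι]
    {C : ι → PointedCone ℝ F} {x : F} :
    x ∈ ⨆ i, C i ↔ ∃ f : ι → F, (∀ i, f i ∈ C i) ∧ ∑ i, f i = x := by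
  have := Submodule.mem_iSup_finset_iff_exists_sum (s := Finset.univ) C x
  simp only [Finset.mem_univ, iSup_pos] at this
  rw [this]
  exact ⟨fun ⟨μ, h⟩ => ⟨fun i => μ i, fun i => (μ i).2, h⟩,
    fun ⟨f, hf, h⟩ => ⟨fun i => ⟨f i, hf i⟩, h⟩⟩

theorem isClosed_iSup_pointedCone {ι : Type*} [Fintype ι] [ProperSpace E]
    {C : ι → PointedCone ℝ E} (hC : ∀ i, IsClosed (C i : Set E))
    (h : ∀ f : ι → E, (∀ i, f i ∈ C i) → ∑ i, f i = 0 → f = 0) :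
    IsClosed ((⨆ i, C i : PointedCone ℝ E) : Set E) := by
  let D : PointedCone ℝ (ι → E) := Submodule.pi Set.univ C
  have hD : (D : Set (ι → E)) = Set.univ.pi fun i => (C i : Set E) := rfl
  let f : (ι → E) →L[ℝ] E := ∑ i, ContinuousLinearMap.proj i
  have hf : ∀ x, f x = ∑ i, x i := fun x => by simp [f]
  have hcl := isClosed_image_of_cone (C := D) (hD ▸ isClosed_set_pi fun i _ => hC i) f
    fun x hx hx0 => h x (fun i => hx i trivial) (by rwa [hf] at hx0)
  convert hcl using 1
  ext x
  rw [SetLike.mem_coe, mem_iSup_pointedCone]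
  constructor
  · rintro ⟨g, hg, rfl⟩
    exact ⟨g, fun i _ => hg i, hf g⟩
  · rintro ⟨g, hg, rfl⟩
    exact ⟨g, fun i => hg i trivial, (hf g).symm⟩

end PointedCone

section Signomial

variable {n m : ℕ} {X : Set (Fin n → ℝ)} {A : Fin m → Fin n → ℝ}

theorem dotp_neg_Amap (ν : Fin m → ℝ) (x : Fin n → ℝ) :
    dotp (-(Amap A ν)) x = -∑ i, ν i * dotp (A i) x := by
  simp only [dotp, Amap, Pi.neg_apply, neg_mul, Finset.sum_neg_distrib, Finset.sum_mul,
    Finset.mul_sum, neg_inj]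
  rw [Finset.sum_comm]
  simp only [mul_assoc]

theorem sigA_le_coe_iff {ν : Fin m → ℝ} {t : ℝ} :
    sigA X A ν ≤ t ↔ ∀ x ∈ X, dotp (-(Amap A ν)) x ≤ t := by
  simp only [sigA, suppFn, iSup₂_le_iff, EReal.coe_le_coe_iff]

theorem sigA_ne_bot (hX : X.Nonempty) (ν : Fin m → ℝ) : sigA X A ν ≠ ⊥ := by
  obtain ⟨x, hx⟩ := hX
  exact ne_bot_of_le_ne_bot (EReal.coe_ne_bot _)
    (le_iSup₂ (f := fun x (_ : x ∈ X) => ((dotp (-(Amap A ν)) x : ℝ) : EReal)) x hx)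

theorem Nbeta_apply_nonpos {b : Fin m} {ν : Fin m → ℝ} (hν : ν ∈ Nbeta b) : ν b ≤ 0 := by
  have := Finset.add_sum_erase Finset.univ ν (Finset.mem_univ b)
  have h := Finset.sum_nonneg fun i (hi : i ∈ Finset.univ.erase b) =>
    hν.1 i (Finset.ne_of_mem_erase hi)
  linarith [hν.2]

theorem eq_zero_of_mem_Nbeta {b : Fin m} {ν : Fin m → ℝ} (hν : ν ∈ Nbeta b)
    (h : ∀ i, i ≠ b → ν i ≤ 0) : ν = 0 := by
  have h0 : ∀ i, i ≠ b → ν i = 0 := fun i hi => le_antisymm (h i hi) (hν.1 i hi)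
  have hb : ν b = 0 := by
    rw [← hν.2]
    exact (Finset.sum_eq_single b (fun i _ hi => h0 i hi) (by simp)).symm
  ext i
  by_cases hi : i = b
  · rw [hi]; exact hb
  · exact h0 i hi

theorem Nbeta_apply_neg {b : Fin m} {ν : Fin m → ℝ} (hν : ν ∈ Nbeta b) (h0 : ν ≠ 0) :
    ν b < 0 := by
  refine lt_of_le_of_ne (Nbeta_apply_nonpos hν) fun hb => h0 ?_
  have hnn : ∀ i ∈ Finset.univ, 0 ≤ ν i := fun i _ => by
    by_cases hi : i = b
    · rw [hi, hb]
    · exact hν.1 i hi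
  exact funext fun i => (Finset.sum_eq_zero_iff_of_nonneg hnn).1 hν.2 i (Finset.mem_univ i)

/-- The epigraph of `ν ↦ σ_X(-𝒜ν)` on `N_β`. -/
def epiCone (X : Set (Fin n → ℝ)) (A : Fin m → Fin n → ℝ) (b : Fin m) :
    PointedCone ℝ ((Fin m → ℝ) × ℝ) where
  carrier := {p | p.1 ∈ Nbeta b ∧ ∀ x ∈ X, -∑ i, p.1 i * dotp (A i) x ≤ p.2}
  zero_mem' := ⟨⟨by simp, by simp⟩, by simp⟩
  add_mem' := by
    rintro p q ⟨⟨hp, hp0⟩, hpX⟩ ⟨⟨hq, hq0⟩, hqX⟩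
    refine ⟨⟨fun i hi => add_nonneg (hp i hi) (hq i hi), ?_⟩, fun x hx => ?_⟩
    · simp [Finset.sum_add_distrib, hp0, hq0]
    · have := add_le_add (hpX x hx) (hqX x hx)
      simpa [add_mul, Finset.sum_add_distrib, add_comm] using this
  smul_mem' := by
    rintro ⟨c, hc⟩ p ⟨⟨hp, hp0⟩, hpX⟩
    refine ⟨⟨fun i hi => mul_nonneg hc (hp i hi), ?_⟩, fun x hx => ?_⟩
    · change ∑ i, c * p.1 i = 0
      rw [← Finset.mul_sum, hp0, mul_zero]
    · change -∑ i, c * p.1 i * dotp (A i) x ≤ c * p.2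
      simpa [mul_assoc, ← Finset.mul_sum] using mul_le_mul_of_nonneg_left (hpX x hx) hc

theorem mem_epiCone {b : Fin m} {p : (Fin m → ℝ) × ℝ} :
    p ∈ epiCone X A b ↔ p.1 ∈ Nbeta b ∧ ∀ x ∈ X, -∑ i, p.1 i * dotp (A i) x ≤ p.2 := .rfl

theorem mem_epiCone_iff_sigA_le {b : Fin m} {p : (Fin m → ℝ) × ℝ} :
    p ∈ epiCone X A b ↔ p.1 ∈ Nbeta b ∧ sigA X A p.1 ≤ p.2 := by
  simp only [mem_epiCone, sigA_le_coe_iff, dotp_neg_Amap]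

theorem phiVec_mem_epiCone {b : Fin m} {ν : Fin m → ℝ} (hν : ν ∈ Nbeta b)
    (h : sigA X A ν < ⊤) : phiVec X A ν ∈ epiCone X A b :=
  mem_epiCone_iff_sigA_le.2 ⟨hν, EReal.le_coe_toReal h.ne⟩

theorem zero_one_mem_epiCone (b : Fin m) : ((0 : Fin m → ℝ), (1 : ℝ)) ∈ epiCone X A b :=
  ⟨⟨by simp, by simp⟩, by simp⟩

theorem isClosed_epiCone (b : Fin m) :
    IsClosed (epiCone X A b : Set ((Fin m → ℝ) × ℝ)) := by
  have : (epiCone X A b : Set ((Fin m → ℝ) × ℝ)) =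
      ((⋂ i, ⋂ (_ : i ≠ b), {p | 0 ≤ p.1 i}) ∩ {p | ∑ i, p.1 i = 0}) ∩
        ⋂ x ∈ X, {p | -∑ i, p.1 i * dotp (A i) x ≤ p.2} := by
    ext p
    simp [mem_epiCone, Nbeta]
  rw [this]
  refine IsClosed.inter (IsClosed.inter ?_ ?_) ?_
  · exact isClosed_iInter fun i => isClosed_iInter fun _ =>
      isClosed_le (by fun_prop) (by fun_prop)
  · exact isClosed_eq (by fun_prop) (by fun_prop)
  · exact isClosed_biInter fun x _ => isClosed_le (by fun_prop) (by fun_prop)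

theorem snd_nonneg_of_fst_eq_zero {b : Fin m} (hX : X.Nonempty) {p : (Fin m → ℝ) × ℝ}
    (hp : p ∈ epiCone X A b) (h : p.1 = 0) : 0 ≤ p.2 := by
  obtain ⟨x, hx⟩ := hX
  simpa [h] using hp.2 x hx

theorem epiCone_salient {b : Fin m} (hX : X.Nonempty) {p : (Fin m → ℝ) × ℝ}
    (hp : p ∈ epiCone X A b) (hn : -p ∈ epiCone X A b) : p = 0 := by
  have h1 : p.1 = 0 :=
    eq_zero_of_mem_Nbeta hp.1 fun i hi => by simpa using hn.1.1 i hi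
  have h2 := snd_nonneg_of_fst_eq_zero hX hp h1
  have h3 := snd_nonneg_of_fst_eq_zero hX hn (by simp [h1])
  exact Prod.ext h1 (le_antisymm (by simpa using h3) h2)

theorem ExpLinIndep.exists_sub_ne (hLI : ExpLinIndep X A) (x₀ : Fin n → ℝ) {i j : Fin m}
    (hij : i ≠ j) :
    ∃ x ∈ X, dotp (A i) x - dotp (A i) x₀ ≠ dotp (A j) x - dotp (A j) x₀ := by
  by_contra! hcon
  refine hij (hLI.eq_of_smul_apply_eq_smul_apply 1
    (Real.exp (dotp (A i) x₀ - dotp (A j) x₀)) i j one_ne_zero (funext fun x => ?_))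
  have : dotp (A i) x = (dotp (A i) x₀ - dotp (A j) x₀) + dotp (A j) x := by
    linarith [hcon x x.2]
  simp only [Pi.smul_apply, smul_eq_mul, one_mul]
  rw [this, Real.exp_add]

/-- If the functions `exp(αᵀx)` are linearly independent on `X`, no nontrivial family of points of
the epigraph cones sums to zero. -/
theorem epiCone_family_eq_zero (hX : X.Nonempty) (hLI : ExpLinIndep X A)
    (f : Fin m → (Fin m → ℝ) × ℝ) (hf : ∀ b, f b ∈ epiCone X A b) (hsum : ∑ b, f b = 0) :
    f = 0 := by
  obtain ⟨x₀, hx₀⟩ := hX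
  have hsum1 : ∀ i, ∑ b, (f b).1 i = 0 := fun i => by
    simpa [Prod.fst_sum] using congrFun (congrArg Prod.fst hsum) i
  have hsum2 : ∑ b, (f b).2 = 0 := by simpa [Prod.snd_sum] using congrArg Prod.snd hsum
  set g : Fin m → (Fin n → ℝ) → ℝ := fun i x => dotp (A i) x - dotp (A i) x₀ with hg
  have htight : ∀ b, ∀ x ∈ X, (f b).2 + ∑ i, (f b).1 i * dotp (A i) x = 0 := by
    intro b x hx
    refine (Finset.sum_eq_zero_iff_of_nonneg (s := Finset.univ)
      (f := fun b => (f b).2 + ∑ i, (f b).1 i * dotp (A i) x)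
      (fun b _ => by linarith [(hf b).2 x hx])).1 ?_ b (Finset.mem_univ b)
    rw [Finset.sum_add_distrib, hsum2, Finset.sum_comm, zero_add]
    simp [← Finset.sum_mul, hsum1]
  have haff : ∀ b, ∀ x ∈ X, ∑ i, (f b).1 i * g i x = 0 := by
    intro b x hx
    simp only [hg, mul_sub, Finset.sum_sub_distrib]
    linarith [htight b x hx, htight b x₀ hx₀]
  have hsep : ∀ p : Fin m × Fin m, ∃ x ∈ X, p.1 ≠ p.2 → g p.1 x ≠ g p.2 x := by
    rintro ⟨i, j⟩
    by_cases hij : i = j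
    · exact ⟨x₀, hx₀, fun h => absurd hij h⟩
    · obtain ⟨x, hx, hne⟩ := hLI.exists_sub_ne x₀ hij
      exact ⟨x, hx, fun _ => hne⟩
  choose z hzX hz using hsep
  set h : Fin m → ℝ := fun i => ∑ p, g i (z p) ^ 2 with hh
  have hvar : ∀ b, ∑ i, (f b).1 i * ∑ p, (g i (z p) - g b (z p)) ^ 2 =
      ∑ i, (f b).1 i * h i := by
    intro b
    simp only [hh, Finset.mul_sum]
    rw [Finset.sum_comm, Finset.sum_comm (f := fun i p => (f b).1 i * g i (z p) ^ 2)]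
    refine Finset.sum_congr rfl fun p _ => ?_
    have e : ∀ i, (f b).1 i * (g i (z p) - g b (z p)) ^ 2 = (f b).1 i * g i (z p) ^ 2
        - 2 * g b (z p) * ((f b).1 i * g i (z p)) + g b (z p) ^ 2 * (f b).1 i := fun i => by ring
    simp only [e, Finset.sum_add_distrib, Finset.sum_sub_distrib, ← Finset.mul_sum,
      haff b _ (hzX p), (hf b).1.2]
    ring
  have hfst : ∀ b, (f b).1 = 0 := by
    by_contra! hne
    obtain ⟨b₀, hb₀⟩ := hne
    classical
    -- among the indices of nonzero summands, `b` has a feature vector of maximal norm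
    obtain ⟨b, hb, hmax⟩ := Finset.exists_max_image
      (Finset.univ.filter fun b => (f b).1 ≠ 0) h ⟨b₀, by simp [hb₀]⟩
    simp only [Finset.mem_filter, Finset.mem_univ, true_and] at hb hmax
    have hsupp : ∀ i, (f i).1 = 0 → (f b).1 i = 0 := by
      intro i hi
      have hnn : ∀ c ∈ Finset.univ, 0 ≤ (f c).1 i := fun c _ => by
        by_cases hc : i = c
        · rw [← hc, hi]; rfl
        · exact (hf c).1.1 i hc
      exact (Finset.sum_eq_zero_iff_of_nonneg hnn).1 (hsum1 i) b (Finset.mem_univ b)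
    have hle : ∑ i, (f b).1 i * h i ≤ 0 := by
      rw [show (0 : ℝ) = ∑ i, (f b).1 i * h b by rw [← Finset.sum_mul, (hf b).1.2, zero_mul]]
      refine Finset.sum_le_sum fun i _ => ?_
      by_cases hib : i = b
      · rw [hib]
      by_cases hi : (f i).1 = 0
      · simp [hsupp i hi]
      · exact mul_le_mul_of_nonneg_left (hmax i hi) ((hf b).1.1 i hib)
    rw [← hvar b] at hle
    have hnn : ∀ i ∈ Finset.univ, 0 ≤ (f b).1 i * ∑ p, (g i (z p) - g b (z p)) ^ 2 :=
      fun i _ => by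
        by_cases hib : i = b
        · simp [hib]
        · exact mul_nonneg ((hf b).1.1 i hib) (Finset.sum_nonneg fun p _ => sq_nonneg _)
    refine hb (eq_zero_of_mem_Nbeta (hf b).1 fun i hib => ?_)
    have hi := (Finset.sum_eq_zero_iff_of_nonneg hnn).1
      (le_antisymm hle (Finset.sum_nonneg hnn)) i (Finset.mem_univ i)
    have hpos : 0 < ∑ p, (g i (z p) - g b (z p)) ^ 2 :=
      Finset.sum_pos' (fun p _ => sq_nonneg _)
        ⟨(i, b), Finset.mem_univ _, by
          have := sub_ne_zero.2 (hz (i, b) hib)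
          positivity⟩
    exact ((mul_eq_zero.1 hi).resolve_right hpos.ne').le
  have hsnd := (Finset.sum_eq_zero_iff_of_nonneg fun b _ =>
    snd_nonneg_of_fst_eq_zero ⟨x₀, hx₀⟩ (hf b) (hfst b)).1 hsum2
  exact funext fun b => Prod.ext (hfst b) (hsnd b (Finset.mem_univ b))

theorem iSup_epiCone_salient (hX : X.Nonempty) (hLI : ExpLinIndep X A) (p : (Fin m → ℝ) × ℝ)
    (hp : p ∈ ⨆ b, epiCone X A b) (hn : -p ∈ ⨆ b, epiCone X A b) : p = 0 := by
  obtain ⟨f, hf, rfl⟩ := mem_iSup_pointedCone.1 hp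
  obtain ⟨g, hg, hfg⟩ := mem_iSup_pointedCone.1 hn
  have h := epiCone_family_eq_zero hX hLI (f + g) (fun b => add_mem (hf b) (hg b))
    (by simp [Finset.sum_add_distrib, hfg])
  refine Finset.sum_eq_zero fun b _ => epiCone_salient hX (hf b) ?_
  rw [neg_eq_of_add_eq_zero_right (congrFun h b)]
  exact hg b

theorem isClosed_iSup_epiCone (hX : X.Nonempty) (hLI : ExpLinIndep X A) :
    IsClosed ((⨆ b, epiCone X A b : PointedCone ℝ ((Fin m → ℝ) × ℝ)) :
      Set ((Fin m → ℝ) × ℝ)) :=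
  isClosed_iSup_pointedCone isClosed_epiCone (epiCone_family_eq_zero hX hLI)

theorem EReal.ne_top_of_convexCombination {a b : EReal} (ha : a ≠ ⊥) (hb : b ≠ ⊥) {θ : ℝ}
    (hθ : θ ∈ Set.Ioo (0 : ℝ) 1) (h : (θ : EReal) * a + ((1 - θ : ℝ) : EReal) * b < ⊤) :
    a ≠ ⊤ ∧ b ≠ ⊤ := by
  have h1 : 0 < 1 - θ := by linarith [hθ.2]
  induction a <;> induction b <;>
    simp_all [EReal.coe_mul_top_of_pos, ← EReal.coe_mul, -EReal.coe_sub]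

/-- An edge generator of an epigraph cone whose coordinate at `b` is `-1` is the functional form
of a normalized circuit. -/
theorem IsEdgeGenerator.fst_mem_LambdaB (hX : X.Nonempty) {b : Fin m} {v : (Fin m → ℝ) × ℝ}
    (hv : IsEdgeGenerator (epiCone X A b : Set ((Fin m → ℝ) × ℝ)) v) (hb : v.1 b = -1) :
    v.1 ∈ LambdaB X A b ∧ v = phiVec X A v.1 := by
  obtain ⟨-, hmem, hedge⟩ := hv
  obtain ⟨hN, hσ⟩ := mem_epiCone_iff_sigA_le.1 hmem
  have hv0 : v.1 ≠ 0 := fun h => by simp [h] at hb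
  have hfin : sigA X A v.1 < ⊤ := hσ.trans_lt (EReal.coe_lt_top _)
  have hs : (sigA X A v.1).toReal ≤ v.2 :=
    EReal.toReal_le_toReal hσ (sigA_ne_bot hX _) (EReal.coe_ne_top _)
  have hphi : v = phiVec X A v.1 := by
    obtain ⟨⟨a, -, ha⟩, -⟩ := hedge ((v.2 - (sigA X A v.1).toReal) • ((0 : Fin m → ℝ), (1 : ℝ)))
      (PointedCone.smul_mem _ (sub_nonneg.2 hs) (zero_one_mem_epiCone b))
      (phiVec X A v.1) (phiVec_mem_epiCone hN hfin) (by ext <;> simp [phiVec])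
    have ha0 : a = 0 := by
      have := congrArg (fun p : (Fin m → ℝ) × ℝ => p.1 b) ha
      simpa [hb] using this
    have := congrArg Prod.snd ha
    simp only [ha0, zero_smul, Prod.smul_snd, smul_eq_mul, mul_one, Prod.snd_zero] at this
    exact Prod.ext rfl (sub_eq_zero.1 this)
  refine ⟨⟨⟨hN, hv0, hfin, ?_⟩, hb⟩, hphi⟩
  rintro ⟨ν₁, ν₂, θ, h₁, h₂, hprop, hθ, hcomb, haff⟩
  have hθ1 : 0 < 1 - θ := by linarith [hθ.2]
  have heq := haff θ ⟨hθ.1.le, hθ.2.le⟩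
  rw [← hcomb] at heq
  obtain ⟨ht₁, ht₂⟩ := EReal.ne_top_of_convexCombination (sigA_ne_bot hX ν₁) (sigA_ne_bot hX ν₂)
    hθ (heq ▸ hfin)
  have hreal : (sigA X A v.1).toReal =
      θ * (sigA X A ν₁).toReal + (1 - θ) * (sigA X A ν₂).toReal := by
    rw [heq, ← EReal.coe_toReal ht₁ (sigA_ne_bot hX ν₁),
      ← EReal.coe_toReal ht₂ (sigA_ne_bot hX ν₂), ← EReal.coe_mul, ← EReal.coe_mul,
      ← EReal.coe_add, EReal.toReal_coe, EReal.toReal_coe, EReal.toReal_coe]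
  obtain ⟨⟨c, -, hc⟩, d, -, hd⟩ := hedge (θ • phiVec X A ν₁)
    (PointedCone.smul_mem _ hθ.1.le (phiVec_mem_epiCone h₁ ht₁.lt_top))
    ((1 - θ) • phiVec X A ν₂)
    (PointedCone.smul_mem _ hθ1.le (phiVec_mem_epiCone h₂ ht₂.lt_top))
    (by rw [hphi]; exact Prod.ext hcomb hreal)
  have hc' : θ • ν₁ = c • v.1 := congrArg Prod.fst hc
  have hd' : (1 - θ) • ν₂ = d • v.1 := congrArg Prod.fst hd
  rw [← eq_inv_smul_iff₀ hθ.1.ne', smul_smul] at hc'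
  rw [← eq_inv_smul_iff₀ hθ1.ne', smul_smul] at hd'
  refine hprop ?_
  by_cases hd0 : d = 0
  · exact ⟨0, Or.inr (by simp [hd', hd0])⟩
  · refine ⟨θ⁻¹ * c * ((1 - θ)⁻¹ * d)⁻¹, Or.inl ?_⟩
    have : (1 - θ)⁻¹ * d ≠ 0 := mul_ne_zero (inv_ne_zero hθ1.ne') hd0
    rw [hc', hd', smul_smul, inv_mul_cancel_right₀ this]

/-- An edge generator of the sum of the epigraph cones spans the ray of `(0, 1)` or of the
functional form of a normalized circuit. -/
theorem IsEdgeGenerator.exists_smul_eq (hX : X.Nonempty) {v : (Fin m → ℝ) × ℝ}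
    (hv : IsEdgeGenerator ((⨆ b, epiCone X A b : PointedCone ℝ ((Fin m → ℝ) × ℝ)) :
      Set ((Fin m → ℝ) × ℝ)) v) :
    ∃ c : ℝ, 0 < c ∧ (c • v = (0, 1) ∨ ∃ l ∈ Lambda X A, c • v = phiVec X A l) := by
  classical
  have hle : ∀ b, epiCone X A b ≤ ⨆ b, epiCone X A b := le_iSup _
  obtain ⟨b, hvb⟩ : ∃ b, v ∈ epiCone X A b := by
    obtain ⟨f, hf, hfv⟩ := mem_iSup_pointedCone.1 hv.2.1
    obtain ⟨b, hb⟩ : ∃ b, f b ≠ 0 := by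
      by_contra! h
      exact hv.1 (by simp [← hfv, h])
    obtain ⟨⟨a, ha, hab⟩, -⟩ := hv.2.2 (f b) (hle b (hf b)) (∑ i ∈ Finset.univ.erase b, f i)
      (sum_mem fun i _ => hle i (hf i)) (by rw [Finset.add_sum_erase _ _ (Finset.mem_univ b), hfv])
    have ha0 : a ≠ 0 := fun h => hb (by rw [hab, h, zero_smul])
    refine ⟨b, ?_⟩
    rw [← inv_smul_smul₀ ha0 v, ← hab]
    exact PointedCone.smul_mem _ (inv_nonneg.2 ha) (hf b)
  by_cases h0 : v.1 = 0
  · have h2 : 0 < v.2 := lt_of_le_of_ne (snd_nonneg_of_fst_eq_zero hX hvb h0)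
      fun h => hv.1 (Prod.ext h0 h.symm)
    exact ⟨v.2⁻¹, inv_pos.2 h2, Or.inl (Prod.ext (by simp [h0]) (by simp [h2.ne']))⟩
  · have hneg := Nbeta_apply_neg hvb.1 h0
    have hpos : 0 < (-v.1 b)⁻¹ := inv_pos.2 (neg_pos.2 hneg)
    have hedge := (hv.mono (hle b) hvb).smul hpos
    obtain ⟨hl, heq⟩ := hedge.fst_mem_LambdaB hX (by
      rw [Prod.smul_fst, Pi.smul_apply, smul_eq_mul, inv_neg, neg_mul, inv_mul_cancel₀ hneg.ne])
    exact ⟨_, hpos, Or.inr ⟨_, Set.mem_iUnion.2 ⟨b, hl⟩, heq⟩⟩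

end Signomial

theorem statement13 {n m : ℕ} (X : Set (Fin n → ℝ)) (hXne : X.Nonempty) (hXcl : IsClosed X)
    (hXcv : Convex ℝ X) (A : Fin m → Fin n → ℝ) (hA : Function.Injective A) (hm : 0 < m)
    (hLI : ExpLinIndep X A) :
    circuitGraph X A =
      coneHull ((phiVec X A '' LambdaStar X A) ∪ {((0 : Fin m → ℝ), (1 : ℝ))}) := by
  set e : (Fin m → ℝ) × ℝ := (0, 1)
  set G : PointedCone ℝ ((Fin m → ℝ) × ℝ) := ⨆ b, epiCone X A b
  set T : Set (Fin m → ℝ) :=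
    {l | l ∈ Lambda X A ∧ IsEdgeGenerator (G : Set ((Fin m → ℝ) × ℝ)) (phiVec X A l)}
  have h₁ : G ≤ PointedCone.hull ℝ (phiVec X A '' T ∪ {e}) := by
    intro v hv
    refine Submodule.span_le.2 (fun u hu => ?_) (mem_hull_edgeGenerators
      (isClosed_iSup_epiCone hXne hLI) (iSup_epiCone_salient hXne hLI) hv)
    obtain ⟨c, hc, h⟩ := IsEdgeGenerator.exists_smul_eq hXne hu
    rw [SetLike.mem_coe, ← inv_smul_smul₀ hc.ne' u]
    refine PointedCone.smul_mem _ (inv_nonneg.2 hc.le) (Submodule.subset_span ?_)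
    rcases h with h | ⟨l, hl, h⟩
    · exact Or.inr h
    · exact Or.inl ⟨l, ⟨hl, h ▸ IsEdgeGenerator.smul hu hc⟩, h.symm⟩
  have h₂ : PointedCone.hull ℝ (phiVec X A '' T ∪ {e}) ≤
      PointedCone.hull ℝ (phiVec X A '' Lambda X A ∪ {e}) :=
    Submodule.span_mono (Set.union_subset_union_left _ (Set.image_mono fun _ h => h.1))
  have h₃ : PointedCone.hull ℝ (phiVec X A '' Lambda X A ∪ {e}) ≤ G := by
    refine Submodule.span_le.2 (Set.union_subset ?_ ?_)
    · rintro _ ⟨l, hl, rfl⟩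
      obtain ⟨b, hb⟩ := Set.mem_iUnion.1 hl
      exact Submodule.mem_iSup_of_mem b (phiVec_mem_epiCone hb.1.1 hb.1.2.2.1)
    · rintro _ rfl
      exact Submodule.mem_iSup_of_mem ⟨0, hm⟩ (zero_one_mem_epiCone _)
  have hgraph : circuitGraph X A = G := by
    rw [circuitGraph, coneHull_eq_hull, le_antisymm h₃ (h₁.trans h₂)]
  have hstar : LambdaStar X A = T := by rw [LambdaStar, hgraph]
  rw [hstar, hgraph, coneHull_eq_hull, le_antisymm (h₂.trans h₃) h₁]
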